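/- arXiv:2312.14019 — 2 statements merged into one kernel-verified Lean document; each statement's English description precedes it below -/
import Mathlib

section
/- In the setting of the block algebra A ≅ ⊕_{J ∈ Fin m} 1_{n_J} ⊗ M_{d_J}(ℂ) acting on matrices indexed by H := Σ J : Fin m, (Fin n_J × Fin d_J) with D := Σ_J n_J·d_J, assume collinearity: there exists λ > 0 with n_J = λ·d_J for all J. Then the self-MAN satisfies NC(A) = 1 − m/(Σ_J d_J²); here m is the dimension of the center of A and Σ_J d_J² is dim_ℂ(A). -/
open MeasureTheory Matrix Kronecker

noncomputable section

instance matMeasurableSpace (n : Type*) [Fintype n] : MeasurableSpace (Matrix n n ℂ) :=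
  show MeasurableSpace (n → n → ℂ) from inferInstance

/-- Squared Frobenius (Hilbert-Schmidt) norm `‖X‖₂² = Tr(X† X)`. -/
def hs2 {n : Type*} [Fintype n] (X : Matrix n n ℂ) : ℝ := (Matrix.trace (Xᴴ * X)).re

/-- Mutual Averaged Non-commutativity: `(1/(2d)) ∫∫ ‖UV - VU‖₂² dμ(U) dν(V)`,
where `μ`, `ν` are meant to be the normalized Haar measures of the unitary groups of
the two algebras (imposed by the `IsHaar` hypotheses in the theorems below). -/
def MAN {n : Type*} [Fintype n] (μ ν : Measure (Matrix n n ℂ)) : ℝ :=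
  (1 / (2 * (Fintype.card n : ℝ))) * ∫ U, ∫ V, hs2 (U * V - V * U) ∂ν ∂μ

/-- `μ` is the normalized Haar probability measure of the compact unitary group
`U(A) = {U ∈ A : U†U = UU† = 1}` of the star-subalgebra `A`, viewed as a measure on
matrix space concentrated on `U(A)` and invariant under left translation by `U(A)`. -/
def IsHaar {n : Type*} [Fintype n] [DecidableEq n] (A : StarSubalgebra ℂ (Matrix n n ℂ))
    (μ : Measure (Matrix n n ℂ)) : Prop :=
  IsProbabilityMeasure μ ∧
  μ {U | ¬ (U ∈ A ∧ U ∈ unitary (Matrix n n ℂ))} = 0 ∧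
  ∀ U ∈ A, U ∈ unitary (Matrix n n ℂ) → μ.map (fun V => U * V) = μ

/-- The block algebra `⊕_J 1_{n_J} ⊗ M_{d_J}(ℂ)` acting on `⊕_J ℂ^{n_J} ⊗ ℂ^{d_J}`. -/
def blockCarrier (m : ℕ) (n dv : Fin m → ℕ) :
    Set (Matrix ((J : Fin m) × (Fin (n J) × Fin (dv J)))
      ((J : Fin m) × (Fin (n J) × Fin (dv J))) ℂ) :=
  {X | ∃ M : (J : Fin m) → Matrix (Fin (dv J)) (Fin (dv J)) ℂ,
    (∀ p q, p.1 ≠ q.1 → X p q = 0) ∧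
    (∀ (J : Fin m) (a b : Fin (n J)) (l l' : Fin (dv J)),
      X ⟨J, (a, l)⟩ ⟨J, (b, l')⟩ = if a = b then M J l l' else 0)}

section BlockMatrix

variable {m : ℕ} {n dv : Fin m → ℕ}

/-- The block matrix `⊕_J 1_{n_J} ⊗ M_J`. -/
def blockEmbed (n : Fin m → ℕ) {dv : Fin m → ℕ}
    (M : (J : Fin m) → Matrix (Fin (dv J)) (Fin (dv J)) ℂ) :
    Matrix ((J : Fin m) × (Fin (n J) × Fin (dv J))) ((J : Fin m) × (Fin (n J) × Fin (dv J))) ℂ :=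
  blockDiagonal' fun J => (1 : Matrix (Fin (n J)) (Fin (n J)) ℂ) ⊗ₖ M J

/-- The first `J`-th diagonal block of a matrix on `⊕_J ℂ^{n_J} ⊗ ℂ^{d_J}`. -/
def firstBlock (hn : ∀ J, 1 ≤ n J) (J : Fin m)
    (X : Matrix ((J : Fin m) × (Fin (n J) × Fin (dv J)))
      ((J : Fin m) × (Fin (n J) × Fin (dv J))) ℂ) :
    Matrix (Fin (dv J)) (Fin (dv J)) ℂ :=
  fun k l => X ⟨J, (⟨0, hn J⟩, k)⟩ ⟨J, (⟨0, hn J⟩, l)⟩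

lemma firstBlock_blockEmbed (hn : ∀ J, 1 ≤ n J) (J : Fin m)
    (M : (J : Fin m) → Matrix (Fin (dv J)) (Fin (dv J)) ℂ) :
    firstBlock hn J (blockEmbed n M) = M J := by
  ext k l
  simp [firstBlock, blockEmbed, blockDiagonal'_apply_eq, kroneckerMap_apply]

lemma mem_blockCarrier_iff
    {X : Matrix ((J : Fin m) × (Fin (n J) × Fin (dv J)))
      ((J : Fin m) × (Fin (n J) × Fin (dv J))) ℂ} :
    X ∈ blockCarrier m n dv ↔ ∃ M, X = blockEmbed n M := by
  refine exists_congr fun M => ⟨?_, ?_⟩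
  · rintro ⟨hoff, hdiag⟩
    ext ⟨J, a, l⟩ ⟨K, b, l'⟩
    by_cases h : J = K
    · subst h
      rw [hdiag]
      simp [blockEmbed, blockDiagonal'_apply_eq, kroneckerMap_apply, one_apply]
    · rw [hoff _ _ h]
      exact (blockDiagonal'_apply_ne _ _ _ h).symm
  · rintro rfl
    refine ⟨?_, fun J a b l l' => ?_⟩
    · rintro ⟨J, p⟩ ⟨K, q⟩ h
      exact blockDiagonal'_apply_ne _ _ _ h
    · simp [blockEmbed, blockDiagonal'_apply_eq, kroneckerMap_apply, one_apply]

lemma blockEmbed_mul (M N : (J : Fin m) → Matrix (Fin (dv J)) (Fin (dv J)) ℂ) :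
    blockEmbed n M * blockEmbed n N = blockEmbed n fun J => M J * N J := by
  simp only [blockEmbed, ← blockDiagonal'_mul, ← mul_kronecker_mul, one_mul]

lemma blockEmbed_one :
    blockEmbed n (fun J => (1 : Matrix (Fin (dv J)) (Fin (dv J)) ℂ)) = 1 := by
  simp only [blockEmbed, one_kronecker_one]
  exact blockDiagonal'_one

lemma conjTranspose_blockEmbed (M : (J : Fin m) → Matrix (Fin (dv J)) (Fin (dv J)) ℂ) :
    (blockEmbed n M)ᴴ = blockEmbed n fun J => (M J)ᴴ := by
  simp only [blockEmbed, blockDiagonal'_conjTranspose, conjTranspose_kronecker,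
    conjTranspose_one]

lemma trace_blockEmbed (M : (J : Fin m) → Matrix (Fin (dv J)) (Fin (dv J)) ℂ) :
    (blockEmbed n M).trace = ∑ J, (n J : ℂ) * (M J).trace := by
  simp [blockEmbed, trace_blockDiagonal', trace_kronecker]

lemma blockEmbed_mem_unitary {M : (J : Fin m) → Matrix (Fin (dv J)) (Fin (dv J)) ℂ}
    (hM : ∀ J, M J ∈ unitary (Matrix (Fin (dv J)) (Fin (dv J)) ℂ)) :
    blockEmbed n M ∈ unitary (Matrix ((J : Fin m) × (Fin (n J) × Fin (dv J)))
      ((J : Fin m) × (Fin (n J) × Fin (dv J))) ℂ) := by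
  have h1 : ∀ J, (M J)ᴴ * M J = 1 := fun J => (Unitary.mem_iff.1 (hM J)).1
  have h2 : ∀ J, M J * (M J)ᴴ = 1 := fun J => (Unitary.mem_iff.1 (hM J)).2
  rw [Unitary.mem_iff, star_eq_conjTranspose, conjTranspose_blockEmbed, blockEmbed_mul,
    blockEmbed_mul]
  simp only [h1, h2, blockEmbed_one, and_self]

lemma mem_unitary_of_blockEmbed (hn : ∀ J, 1 ≤ n J)
    {M : (J : Fin m) → Matrix (Fin (dv J)) (Fin (dv J)) ℂ}
    (hM : blockEmbed n M ∈ unitary (Matrix ((J : Fin m) × (Fin (n J) × Fin (dv J)))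
      ((J : Fin m) × (Fin (n J) × Fin (dv J))) ℂ)) (J : Fin m) :
    M J ∈ unitary (Matrix (Fin (dv J)) (Fin (dv J)) ℂ) := by
  rw [Unitary.mem_iff, star_eq_conjTranspose, conjTranspose_blockEmbed, blockEmbed_mul,
    blockEmbed_mul, ← blockEmbed_one] at hM
  have h1 := congrArg (firstBlock hn J) hM.1
  have h2 := congrArg (firstBlock hn J) hM.2
  simp only [firstBlock_blockEmbed] at h1 h2
  exact Unitary.mem_iff.2 ⟨h1, h2⟩

end BlockMatrix

lemma hs2_commutator_of_mem_unitary {ι : Type*} [Fintype ι] [DecidableEq ι]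
    {U V : Matrix ι ι ℂ} (hU : U ∈ unitary (Matrix ι ι ℂ)) (hV : V ∈ unitary (Matrix ι ι ℂ)) :
    hs2 (U * V - V * U) = 2 * Fintype.card ι - 2 * (Vᴴ * Uᴴ * V * U).trace.re := by
  have hU1 : Uᴴ * U = 1 := (Unitary.mem_iff.1 hU).1
  have hV1 : Vᴴ * V = 1 := (Unitary.mem_iff.1 hV).1
  have e1 : (U * V)ᴴ * (U * V) = 1 := by
    rw [conjTranspose_mul, Matrix.mul_assoc, ← Matrix.mul_assoc Uᴴ, hU1, Matrix.one_mul, hV1]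
  have e2 : (V * U)ᴴ * (V * U) = 1 := by
    rw [conjTranspose_mul, Matrix.mul_assoc, ← Matrix.mul_assoc Vᴴ, hV1, Matrix.one_mul, hU1]
  have e3 : (U * V)ᴴ * (V * U) = Vᴴ * Uᴴ * V * U := by
    rw [conjTranspose_mul, ← Matrix.mul_assoc]
  have e4 : ((V * U)ᴴ * (U * V)).trace.re = (Vᴴ * Uᴴ * V * U).trace.re := by
    have : (V * U)ᴴ * (U * V) = (Vᴴ * Uᴴ * V * U)ᴴ := by
      rw [← e3, conjTranspose_mul (U * V)ᴴ, conjTranspose_conjTranspose]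
    rw [this, trace_conjTranspose]
    simp
  have e5 : (U * V - V * U)ᴴ * (U * V - V * U) =
      (U * V)ᴴ * (U * V) - (U * V)ᴴ * (V * U) - ((V * U)ᴴ * (U * V) - (V * U)ᴴ * (V * U)) := by
    rw [conjTranspose_sub, Matrix.sub_mul, Matrix.mul_sub, Matrix.mul_sub]
  rw [hs2, e5, e1, e2, e3]
  simp only [trace_sub, Complex.sub_re, e4, trace_one, Complex.natCast_re]
  ring

lemma diagonal_reflection_mem_unitary {ι : Type*} [Fintype ι] [DecidableEq ι] (k : ι) :
    diagonal (fun i => if i = k then (-1 : ℂ) else 1) ∈ unitary (Matrix ι ι ℂ) := by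
  rw [Unitary.mem_iff, star_eq_conjTranspose, diagonal_conjTranspose, diagonal_mul_diagonal,
    diagonal_mul_diagonal, ← diagonal_one]
  constructor <;> congr 1 <;> ext i <;> by_cases h : i = k <;> simp [h]

lemma permMatrix_mem_unitary {ι : Type*} [Fintype ι] [DecidableEq ι] (σ : Equiv.Perm ι) :
    σ.permMatrix ℂ ∈ unitary (Matrix ι ι ℂ) := by
  rw [Unitary.mem_iff, star_eq_conjTranspose, conjTranspose_permMatrix, ← permMatrix_mul,
    ← permMatrix_mul]
  simp

lemma trace_conjTranspose_mul_expand {ι : Type*} [Fintype ι] (U V : Matrix ι ι ℂ) :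
    (Vᴴ * Uᴴ * V * U).trace =
      ∑ a, ∑ d, ∑ c, ∑ b, U d a * star (U c b) * (V c d * star (V b a)) := by
  simp only [trace, diag_apply, mul_apply, conjTranspose_apply, Finset.sum_mul]
  refine Finset.sum_congr rfl fun a _ => Finset.sum_congr rfl fun d _ =>
    Finset.sum_congr rfl fun c _ => Finset.sum_congr rfl fun b _ => ?_
  ring

lemma integral_const_sub_two_mul_re {Ω : Type*} [MeasurableSpace Ω] {μ : Measure Ω}
    [IsProbabilityMeasure μ] (c : ℝ) {F : Ω → ℂ} (hF : Integrable F μ) :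
    ∫ x, (c - 2 * (F x).re) ∂μ = c - 2 * (∫ x, F x ∂μ).re := by
  have hre : ∫ x, (F x).re ∂μ = (∫ x, F x ∂μ).re := integral_re hF
  have hint : Integrable (fun x => (F x).re) μ := hF.re
  rw [integral_sub (integrable_const _) (hint.const_mul 2), integral_const_mul, integral_const,
    probReal_univ, one_smul, hre]

section Haar

variable {m : ℕ} {n dv : Fin m → ℕ}
  {A : StarSubalgebra ℂ (Matrix ((J : Fin m) × (Fin (n J) × Fin (dv J)))
      ((J : Fin m) × (Fin (n J) × Fin (dv J))) ℂ)}
  {μ : Measure (Matrix ((J : Fin m) × (Fin (n J) × Fin (dv J)))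
      ((J : Fin m) × (Fin (n J) × Fin (dv J))) ℂ)}

lemma measurable_matrix_apply {ι : Type*} [Fintype ι] (i j : ι) :
    Measurable fun X : Matrix ι ι ℂ => X i j :=
  (measurable_pi_apply j).comp (measurable_pi_apply i)

lemma measurable_matrix_mul_left {ι : Type*} [Fintype ι] (W : Matrix ι ι ℂ) :
    Measurable fun X : Matrix ι ι ℂ => W * X := by
  refine measurable_pi_lambda _ fun i => measurable_pi_lambda _ fun j => ?_
  simp only [mul_apply]
  exact Finset.measurable_sum _ fun k _ => (measurable_matrix_apply k j).const_mul _

lemma measurable_firstBlock_apply (hn : ∀ J, 1 ≤ n J) (J : Fin m) (k l : Fin (dv J)) :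
    Measurable fun X : Matrix ((J : Fin m) × (Fin (n J) × Fin (dv J)))
      ((J : Fin m) × (Fin (n J) × Fin (dv J))) ℂ => firstBlock hn J X k l :=
  measurable_matrix_apply _ _

lemma measurable_firstBlock_mul_star (hn : ∀ J, 1 ≤ n J) (J : Fin m) (k l k' l' : Fin (dv J)) :
    Measurable fun X : Matrix ((J : Fin m) × (Fin (n J) × Fin (dv J)))
      ((J : Fin m) × (Fin (n J) × Fin (dv J))) ℂ =>
        firstBlock hn J X k l * star (firstBlock hn J X k' l') :=
  (measurable_firstBlock_apply hn J k l).mul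
    (Complex.continuous_conj.measurable.comp (measurable_firstBlock_apply hn J k' l'))

lemma IsHaar.ae_blockEmbed (hn : ∀ J, 1 ≤ n J)
    (hA : (A : Set (Matrix ((J : Fin m) × (Fin (n J) × Fin (dv J)))
      ((J : Fin m) × (Fin (n J) × Fin (dv J))) ℂ)) = blockCarrier m n dv)
    (hμ : IsHaar A μ) :
    ∀ᵐ U ∂μ, U ∈ unitary (Matrix ((J : Fin m) × (Fin (n J) × Fin (dv J)))
        ((J : Fin m) × (Fin (n J) × Fin (dv J))) ℂ) ∧
      U = blockEmbed n (fun J => firstBlock hn J U) ∧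
      ∀ J, firstBlock hn J U ∈ unitary (Matrix (Fin (dv J)) (Fin (dv J)) ℂ) := by
  have h : ∀ᵐ U ∂μ, U ∈ A ∧ U ∈ unitary (Matrix ((J : Fin m) × (Fin (n J) × Fin (dv J)))
        ((J : Fin m) × (Fin (n J) × Fin (dv J))) ℂ) := hμ.2.1
  filter_upwards [h] with U hU
  have hUA : U ∈ blockCarrier m n dv := hA ▸ hU.1
  obtain ⟨M, rfl⟩ := mem_blockCarrier_iff.1 hUA
  simp only [firstBlock_blockEmbed]
  exact ⟨hU.2, trivial, mem_unitary_of_blockEmbed hn hU.2⟩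

lemma IsHaar.integrable_firstBlock_mul_star (hn : ∀ J, 1 ≤ n J)
    (hA : (A : Set (Matrix ((J : Fin m) × (Fin (n J) × Fin (dv J)))
      ((J : Fin m) × (Fin (n J) × Fin (dv J))) ℂ)) = blockCarrier m n dv)
    (hμ : IsHaar A μ) (J : Fin m) (k l k' l' : Fin (dv J)) :
    Integrable (fun V => firstBlock hn J V k l * star (firstBlock hn J V k' l')) μ := by
  have := hμ.1
  refine Integrable.of_bound
    (measurable_firstBlock_mul_star hn J k l k' l').aestronglyMeasurable 1 ?_
  filter_upwards [hμ.ae_blockEmbed hn hA] with V hV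
  rw [norm_mul, norm_star]
  exact mul_le_one₀ (entry_norm_bound_of_unitary (hV.2.2 J) _ _) (norm_nonneg _)
    (entry_norm_bound_of_unitary (hV.2.2 J) _ _)

lemma IsHaar.integral_firstBlock_mul_left (hn : ∀ J, 1 ≤ n J)
    (hA : (A : Set (Matrix ((J : Fin m) × (Fin (n J) × Fin (dv J)))
      ((J : Fin m) × (Fin (n J) × Fin (dv J))) ℂ)) = blockCarrier m n dv)
    (hμ : IsHaar A μ) (J : Fin m) {W : Matrix (Fin (dv J)) (Fin (dv J)) ℂ}
    (hW : W ∈ unitary (Matrix (Fin (dv J)) (Fin (dv J)) ℂ)) (k l k' l' : Fin (dv J)) :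
    ∫ V, firstBlock hn J V k l * star (firstBlock hn J V k' l') ∂μ =
      ∫ V, (W * firstBlock hn J V) k l * star ((W * firstBlock hn J V) k' l') ∂μ := by
  set N : (K : Fin m) → Matrix (Fin (dv K)) (Fin (dv K)) ℂ :=
    Function.update (fun _ => 1) J W with hN
  have hNJ : N J = W := Function.update_self ..
  have hNu : ∀ K, N K ∈ unitary (Matrix (Fin (dv K)) (Fin (dv K)) ℂ) := by
    intro K
    by_cases h : K = J
    · subst h
      rwa [hNJ]
    · rw [hN, Function.update_of_ne h]
      exact one_mem _
  have hNA : blockEmbed n N ∈ A := by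
    rw [← SetLike.mem_coe, hA]
    exact mem_blockCarrier_iff.2 ⟨N, rfl⟩
  have hmap := hμ.2.2 _ hNA (blockEmbed_mem_unitary hNu)
  conv_lhs => rw [← hmap]
  rw [integral_map (measurable_matrix_mul_left _).aemeasurable
    (measurable_firstBlock_mul_star hn J k l k' l').aestronglyMeasurable]
  refine integral_congr_ae ?_
  filter_upwards [hμ.ae_blockEmbed hn hA] with V hV
  have : firstBlock hn J (blockEmbed n N * V) = W * firstBlock hn J V := by
    conv_lhs => rw [hV.2.1, blockEmbed_mul, firstBlock_blockEmbed, hNJ]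
  simp only [this]

/-- Schur orthogonality for the block `J` of a Haar random unitary of the block algebra. -/
lemma IsHaar.integral_firstBlock_mul_star (hn : ∀ J, 1 ≤ n J)
    (hA : (A : Set (Matrix ((J : Fin m) × (Fin (n J) × Fin (dv J)))
      ((J : Fin m) × (Fin (n J) × Fin (dv J))) ℂ)) = blockCarrier m n dv)
    (hμ : IsHaar A μ) (J : Fin m) (k l k' l' : Fin (dv J)) :
    ∫ V, firstBlock hn J V k l * star (firstBlock hn J V k' l') ∂μ =
      if k = k' then if l = l' then ((dv J : ℂ))⁻¹ else 0 else 0 := by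
  have := hμ.1
  by_cases hk : k = k'
  · subst hk
    have hconst : ∀ i, ∫ V, firstBlock hn J V i l * star (firstBlock hn J V i l') ∂μ =
        ∫ V, firstBlock hn J V k l * star (firstBlock hn J V k l') ∂μ := by
      intro i
      rw [hμ.integral_firstBlock_mul_left hn hA J (permMatrix_mem_unitary (Equiv.swap i k))]
      simp only [Equiv.Perm.permMatrix, PEquiv.toMatrix_toPEquiv_mul, submatrix_apply,
        Equiv.swap_apply_left, id_eq]
    have hsum : ∑ i, ∫ V, firstBlock hn J V i l * star (firstBlock hn J V i l') ∂μ =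
        if l = l' then 1 else 0 := by
      rw [← integral_finsetSum _ fun i _ =>
        hμ.integrable_firstBlock_mul_star hn hA J i l i l']
      have : ∀ᵐ V ∂μ, ∑ i, firstBlock hn J V i l * star (firstBlock hn J V i l') =
          if l = l' then 1 else 0 := by
        filter_upwards [hμ.ae_blockEmbed hn hA] with V hV
        have h := congrFun (congrFun (Unitary.mem_iff.1 (hV.2.2 J)).1 l') l
        simp only [star_eq_conjTranspose, mul_apply, conjTranspose_apply, one_apply] at h
        simp only [mul_comm (firstBlock hn J V _ l), h, eq_comm]
      rw [integral_congr_ae this]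
      simp
    rw [Finset.sum_congr rfl fun i _ => hconst i, Finset.sum_const, Finset.card_univ,
      Fintype.card_fin, nsmul_eq_mul] at hsum
    have hd : (dv J : ℂ) ≠ 0 := by
      have := k.pos
      exact_mod_cast this.ne'
    rw [if_pos rfl, eq_comm, ← mul_right_inj' hd, hsum]
    split_ifs <;> simp [hd]
  · have h := hμ.integral_firstBlock_mul_left hn hA J
      (diagonal_reflection_mem_unitary k) k l k' l'
    simp only [diagonal_mul, if_true, if_neg (Ne.symm hk), one_mul, neg_mul] at h
    rw [integral_neg] at h
    rw [if_neg hk]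
    exact self_eq_neg.1 h

end Haar

/-- Self-MAN of a collinear block algebra: `NC(A) = 1 - m/(Σ_J d_J²)`. -/
theorem stmt_15 (m : ℕ) (hm : 1 ≤ m) (n dv : Fin m → ℕ)
    (hn : ∀ J, 1 ≤ n J) (hdv : ∀ J, 1 ≤ dv J)
    (lam : ℝ) (hlam : 0 < lam) (hcol : ∀ J, (n J : ℝ) = lam * (dv J : ℝ))
    (A : StarSubalgebra ℂ (Matrix ((J : Fin m) × (Fin (n J) × Fin (dv J)))
      ((J : Fin m) × (Fin (n J) × Fin (dv J))) ℂ))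
    (hA : (A : Set (Matrix ((J : Fin m) × (Fin (n J) × Fin (dv J)))
      ((J : Fin m) × (Fin (n J) × Fin (dv J))) ℂ)) = blockCarrier m n dv)
    (μ ν : Measure (Matrix ((J : Fin m) × (Fin (n J) × Fin (dv J)))
      ((J : Fin m) × (Fin (n J) × Fin (dv J))) ℂ))
    (hμ : IsHaar A μ) (hν : IsHaar A ν) :
    MAN μ ν = 1 - (m : ℝ) / ((∑ J, (dv J) ^ 2 : ℕ) : ℝ) := by
  have := hμ.1
  have := hν.1
  have hfactor : ∀ J, (n J : ℂ) * (dv J : ℂ)⁻¹ = lam := by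
    intro J
    have hd : (dv J : ℂ) ≠ 0 := by
      have := hdv J
      exact_mod_cast (by omega : dv J ≠ 0)
    rw [mul_inv_eq_iff_eq_mul₀ hd]
    exact_mod_cast hcol J
  have hinner : ∀ᵐ U ∂μ, ∫ V, hs2 (U * V - V * U) ∂ν =
      2 * Fintype.card ((J : Fin m) × (Fin (n J) × Fin (dv J))) -
        2 * (∑ J, (lam : ℂ) * ∑ a, ∑ b,
          firstBlock hn J U a a * star (firstBlock hn J U b b)).re := by
    filter_upwards [hμ.ae_blockEmbed hn hA] with U hU
    have hint : ∀ J (a d c b : Fin (dv J)), Integrable (fun V =>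
        firstBlock hn J U d a * star (firstBlock hn J U c b) *
          (firstBlock hn J V c d * star (firstBlock hn J V b a))) ν := fun J a d c b =>
      (hν.integrable_firstBlock_mul_star hn hA J c d b a).const_mul _
    have hval : ∀ᵐ V ∂ν, hs2 (U * V - V * U) =
        2 * Fintype.card ((J : Fin m) × (Fin (n J) × Fin (dv J))) -
        2 * (∑ J, (n J : ℂ) * ∑ a, ∑ d, ∑ c, ∑ b,
          firstBlock hn J U d a * star (firstBlock hn J U c b) *
          (firstBlock hn J V c d * star (firstBlock hn J V b a))).re := by
      filter_upwards [hν.ae_blockEmbed hn hA] with V hV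
      rw [hs2_commutator_of_mem_unitary hU.1 hV.1]
      have htr : (Vᴴ * Uᴴ * V * U).trace = ∑ J, (n J : ℂ) *
          ((firstBlock hn J V)ᴴ * (firstBlock hn J U)ᴴ *
            firstBlock hn J V * firstBlock hn J U).trace := by
        conv_lhs => rw [hU.2.1, hV.2.1]
        rw [conjTranspose_blockEmbed, conjTranspose_blockEmbed, blockEmbed_mul, blockEmbed_mul,
          blockEmbed_mul, trace_blockEmbed]
      rw [htr]
      simp only [trace_conjTranspose_mul_expand]
    have hsumint : ∀ J, Integrable (fun V => ∑ a, ∑ d, ∑ c, ∑ b,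
          firstBlock hn J U d a * star (firstBlock hn J U c b) *
          (firstBlock hn J V c d * star (firstBlock hn J V b a))) ν := fun J =>
      integrable_finsetSum _ fun a _ => integrable_finsetSum _ fun d _ =>
        integrable_finsetSum _ fun c _ => integrable_finsetSum _ fun b _ => hint J a d c b
    have hFint := integrable_finsetSum Finset.univ fun J _ => (hsumint J).const_mul (n J : ℂ)
    rw [integral_congr_ae hval]
    refine (integral_const_sub_two_mul_re _ hFint).trans ?_
    congr 3
    rw [integral_finsetSum _ fun J _ => (hsumint J).const_mul (n J : ℂ)]
    refine Finset.sum_congr rfl fun J _ => ?_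
    rw [integral_const_mul, ← hfactor J, mul_assoc]
    congr 1
    rw [integral_finsetSum _ fun a _ => integrable_finsetSum _ fun d _ =>
        integrable_finsetSum _ fun c _ => integrable_finsetSum _ fun b _ => hint J a d c b,
      Finset.mul_sum]
    refine Finset.sum_congr rfl fun a _ => ?_
    rw [integral_finsetSum _ fun d _ =>
        integrable_finsetSum _ fun c _ => integrable_finsetSum _ fun b _ => hint J a d c b]
    have hterm : ∀ d, ∫ V, ∑ c, ∑ b,
        firstBlock hn J U d a * star (firstBlock hn J U c b) *
          (firstBlock hn J V c d * star (firstBlock hn J V b a)) ∂ν =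
        ∑ c, ∑ b, firstBlock hn J U d a * star (firstBlock hn J U c b) *
          (if c = b then if d = a then ((dv J : ℂ))⁻¹ else 0 else 0) := by
      intro d
      rw [integral_finsetSum _ fun c _ => integrable_finsetSum _ fun b _ => hint J a d c b]
      refine Finset.sum_congr rfl fun c _ => ?_
      rw [integral_finsetSum _ fun b _ => hint J a d c b]
      refine Finset.sum_congr rfl fun b _ => ?_
      rw [integral_const_mul, hν.integral_firstBlock_mul_star hn hA]
    simp only [hterm, mul_ite, mul_zero, Finset.sum_ite_eq, Finset.mem_univ, if_true]
    rw [Finset.sum_comm]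
    simp only [Finset.sum_ite_eq', Finset.mem_univ, if_true, Finset.mul_sum]
    exact Finset.sum_congr rfl fun b _ => mul_comm _ _
  have hsumint : ∀ J, Integrable (fun U => ∑ a, ∑ b,
      firstBlock hn J U a a * star (firstBlock hn J U b b)) μ := fun J =>
    integrable_finsetSum _ fun a _ => integrable_finsetSum _ fun b _ =>
      hμ.integrable_firstBlock_mul_star hn hA J a a b b
  have hFint := integrable_finsetSum Finset.univ fun J _ => (hsumint J).const_mul (lam : ℂ)
  have hchar : ∀ J, ∫ U, ∑ a, ∑ b,
      firstBlock hn J U a a * star (firstBlock hn J U b b) ∂μ = 1 := by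
    intro J
    have hd : (dv J : ℂ) ≠ 0 := by
      have := hdv J
      exact_mod_cast (by omega : dv J ≠ 0)
    rw [integral_finsetSum _ fun a _ => integrable_finsetSum _ fun b _ =>
      hμ.integrable_firstBlock_mul_star hn hA J a a b b]
    have hterm : ∀ a, ∫ U, ∑ b, firstBlock hn J U a a * star (firstBlock hn J U b b) ∂μ =
        (dv J : ℂ)⁻¹ := by
      intro a
      rw [integral_finsetSum _ fun b _ =>
        hμ.integrable_firstBlock_mul_star hn hA J a a b b]
      simp only [hμ.integral_firstBlock_mul_star hn hA]
      simp
    simp only [hterm]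
    simp [hd]
  have hout : ∫ U, ∑ J, (lam : ℂ) * ∑ a, ∑ b,
      firstBlock hn J U a a * star (firstBlock hn J U b b) ∂μ = ((lam * m : ℝ) : ℂ) := by
    rw [integral_finsetSum _ fun J _ => (hsumint J).const_mul (lam : ℂ)]
    simp only [integral_const_mul, hchar]
    simp [mul_comm]
  have hcard : (Fintype.card ((J : Fin m) × (Fin (n J) × Fin (dv J))) : ℝ) =
      lam * ((∑ J, (dv J) ^ 2 : ℕ) : ℝ) := by
    simp only [Fintype.card_sigma, Fintype.card_prod, Fintype.card_fin]
    push_cast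
    rw [Finset.mul_sum]
    refine Finset.sum_congr rfl fun J _ => ?_
    rw [hcol J]
    ring
  have hpos : (0 : ℝ) < ((∑ J, (dv J) ^ 2 : ℕ) : ℝ) := by
    have : 0 < ∑ J, (dv J) ^ 2 :=
      Finset.sum_pos (fun J _ => pow_pos (hdv J) 2) ⟨⟨0, hm⟩, Finset.mem_univ _⟩
    exact_mod_cast this
  rw [MAN, integral_congr_ae hinner]
  have hre := integral_const_sub_two_mul_re
    (2 * (Fintype.card ((J : Fin m) × (Fin (n J) × Fin (dv J))) : ℝ)) hFint
  rw [hout, Complex.ofReal_re] at hre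
  rw [hre, hcard]
  field_simp
end
end

section
/- Let A, B be hermitian-closed unital subalgebras of M_d(ℂ) with A collinear, i.e. dim_ℂ(A)·dim_ℂ(A') = d². Then S(A : B) ≤ 1 − dim_ℂ(A ∩ B')/dim_ℂ(A), where A ∩ B' is the intersection subalgebra. Moreover, if the Frobenius-orthogonal projections P_A and P_{B'} of M_d(ℂ) onto A and onto B' commute (P_A ∘ P_{B'} = P_{B'} ∘ P_A), then equality holds. -/
open MeasureTheory Matrix Kronecker

noncomputable section

/-- The commutant `A' = {X : XY = YX ∀ Y ∈ A}` as a ℂ-subspace of matrix space. -/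
def commSub {n : Type*} [Fintype n] [DecidableEq n] (A : StarSubalgebra ℂ (Matrix n n ℂ)) :
    Submodule ℂ (Matrix n n ℂ) where
  carrier := {X | ∀ Y ∈ A, X * Y = Y * X}
  add_mem' := by
    intro a b ha hb Y hY
    rw [add_mul, mul_add, ha Y hY, hb Y hY]
  zero_mem' := by
    intro Y hY
    rw [zero_mul, mul_zero]
  smul_mem' := by
    intro c X hX Y hY
    rw [smul_mul_assoc, hX Y hY, mul_smul_comm]

open Module

section

variable {n : Type*} [Fintype n]

/-- A finite family of matrices that is an orthonormal basis of the subspace `S` with respect to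
the Frobenius inner product. -/
structure IsFrobeniusBasis (S : Submodule ℂ (Matrix n n ℂ)) {ι : Type*} [Fintype ι] [DecidableEq ι]
    (f : ι → Matrix n n ℂ) : Prop where
  mem : ∀ i, f i ∈ S
  trace_eq : ∀ i j, trace ((f i)ᴴ * f j) = if i = j then 1 else 0
  sum_eq : ∀ X ∈ S, ∑ i, trace ((f i)ᴴ * X) • f i = X

theorem exists_linearEquiv_euclideanSpace :
    ∃ e : Matrix n n ℂ ≃ₗ[ℂ] EuclideanSpace ℂ (n × n),
      ∀ X Y, inner ℂ (e X) (e Y) = trace (Xᴴ * Y) := by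
  refine ⟨(LinearEquiv.curry ℂ ℂ n n).symm.trans (WithLp.linearEquiv 2 ℂ (n × n → ℂ)).symm,
    fun X Y => ?_⟩
  rw [PiLp.inner_apply, Fintype.sum_prod_type_right]
  simp only [trace, Matrix.diag, Matrix.mul_apply, Matrix.conjTranspose_apply]
  refine Finset.sum_congr rfl fun i _ => Finset.sum_congr rfl fun j _ => ?_
  rw [RCLike.inner_apply, mul_comm]
  rfl

theorem exists_isFrobeniusBasis (S : Submodule ℂ (Matrix n n ℂ)) :
    ∃ f : Fin (finrank ℂ S) → Matrix n n ℂ, IsFrobeniusBasis S f := by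
  obtain ⟨e, he⟩ := exists_linearEquiv_euclideanSpace (n := n)
  obtain ⟨T, hT⟩ : ∃ T : Submodule ℂ (EuclideanSpace ℂ (n × n)),
      T = S.map (e : Matrix n n ℂ →ₗ[ℂ] EuclideanSpace ℂ (n × n)) := ⟨_, rfl⟩
  have hST : finrank ℂ T = finrank ℂ S := hT ▸ LinearEquiv.finrank_map_eq e S
  have hmem : ∀ X, e X ∈ T ↔ X ∈ S := fun X => by simp [hT]
  let b := (stdOrthonormalBasis ℂ T).reindex (finCongr hST)
  refine ⟨fun i => e.symm (b i), fun i => ?_, fun i j => ?_, fun X hX => ?_⟩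
  · rw [← hmem, e.apply_symm_apply]
    exact (b i).2
  · rw [← he, e.apply_symm_apply, e.apply_symm_apply, ← Submodule.coe_inner,
      orthonormal_iff_ite.mp b.orthonormal]
  · apply e.injective
    have := congrArg Subtype.val (b.sum_repr' ⟨e X, (hmem X).2 hX⟩)
    simp only [map_sum, map_smul, ← he, e.apply_symm_apply]
    simpa using this

open scoped Matrix.Norms.L2Operator in
theorem mem_span_unitary [DecidableEq n] (A : StarSubalgebra ℂ (Matrix n n ℂ)) {X : Matrix n n ℂ}
    (hX : X ∈ A) :
    X ∈ Submodule.span ℂ {U | U ∈ A ∧ U ∈ unitary (Matrix n n ℂ)} := by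
  have : IsClosed (A : Set (Matrix n n ℂ)) :=
    (Subalgebra.toSubmodule A.toSubalgebra).closed_of_finiteDimensional
  let _ : CStarAlgebra A := StarSubalgebra.cstarAlgebra A (h_closed := this)
  have h : (⟨X, hX⟩ : A) ∈ Submodule.span ℂ (unitary A : Set A) := by
    rw [CStarAlgebra.span_unitary]; trivial
  have h2 := Submodule.mem_map_of_mem (f := A.subtype.toLinearMap) h
  rw [Submodule.map_span] at h2
  refine Submodule.span_mono ?_ h2
  rintro _ ⟨U, hU, rfl⟩
  exact ⟨U.2, by simpa [Unitary.mem_iff, Subtype.ext_iff] using hU⟩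


/-- The completely positive map `X ↦ ∑ i, f i * X * (f i)ᴴ`. -/
def krausSum {ι : Type*} [Fintype ι] (f : ι → Matrix n n ℂ) (X : Matrix n n ℂ) : Matrix n n ℂ :=
  ∑ i, f i * X * (f i)ᴴ

/-- The Frobenius-orthogonal projection onto the span of an orthonormal family `f`. -/
def frobeniusProj {ι : Type*} [Fintype ι] (f : ι → Matrix n n ℂ) (X : Matrix n n ℂ) :
    Matrix n n ℂ :=
  ∑ i, trace ((f i)ᴴ * X) • f i

open scoped ComplexOrder in
theorem eq_of_trace_orthogonal {S : Submodule ℂ (Matrix n n ℂ)} {X P Q : Matrix n n ℂ}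
    (hP : P ∈ S) (hQ : Q ∈ S) (hXP : ∀ Y ∈ S, trace (Yᴴ * (X - P)) = 0)
    (hXQ : ∀ Y ∈ S, trace (Yᴴ * (X - Q)) = 0) : P = Q := by
  rw [← sub_eq_zero, ← trace_conjTranspose_mul_self_eq_zero_iff]
  have h1 := hXP _ (S.sub_mem hP hQ)
  have h2 := hXQ _ (S.sub_mem hP hQ)
  have h3 : P - Q = (X - Q) - (X - P) := by abel
  conv_lhs => rw [h3, mul_sub, ← h3, trace_sub, h1, h2, sub_zero]

theorem trace_conjTranspose_mul_comm (X Y : Matrix n n ℂ) :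
    star (trace (Xᴴ * Y)) = trace (Yᴴ * X) := by
  rw [← trace_conjTranspose, conjTranspose_mul, conjTranspose_conjTranspose]

theorem trace_conjTranspose_mul_krausSum {ι : Type*} [Fintype ι] (f : ι → Matrix n n ℂ)
    (W X : Matrix n n ℂ) :
    trace (Wᴴ * krausSum f X) = trace ((krausSum (fun i => (f i)ᴴ) W)ᴴ * X) := by
  simp only [krausSum, conjTranspose_sum, Finset.mul_sum, Finset.sum_mul, trace_sum,
    conjTranspose_mul, conjTranspose_conjTranspose]
  refine Finset.sum_congr rfl fun i _ => ?_
  rw [← mul_assoc, trace_mul_comm]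
  simp only [mul_assoc]

theorem trace_mul_eq_sum (W Z : Matrix n n ℂ) :
    trace (W * Z) = ∑ i, ∑ j, W i j * Z j i := by
  simp only [trace, diag_apply, Matrix.mul_apply]

open scoped ComplexOrder in
theorem re_trace_conjTranspose_mul_self_nonneg (X : Matrix n n ℂ) : 0 ≤ (trace (Xᴴ * X)).re :=
  (Complex.le_def.1 (posSemidef_conjTranspose_mul_self X).trace_nonneg).1

theorem measurable_entry (i j : n) : Measurable fun U : Matrix n n ℂ => U i j :=
  (measurable_pi_apply j).comp (measurable_pi_apply (X := fun _ : n => n → ℂ) i)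

theorem measurable_const_mul_matrix (V : Matrix n n ℂ) :
    Measurable fun U : Matrix n n ℂ => V * U := by
  refine measurable_pi_lambda _ fun i => measurable_pi_lambda _ fun j => ?_
  simp only [Matrix.mul_apply]
  exact Finset.measurable_sum _ fun k _ => (measurable_entry k j).const_mul _

namespace IsFrobeniusBasis

variable {S : Submodule ℂ (Matrix n n ℂ)} {ι : Type*} [Fintype ι] [DecidableEq ι]
  {f : ι → Matrix n n ℂ}

theorem frobeniusProj_mem (hf : IsFrobeniusBasis S f) (X : Matrix n n ℂ) : frobeniusProj f X ∈ S :=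
  S.sum_mem fun i _ => S.smul_mem _ (hf.mem i)

theorem trace_sub_frobeniusProj (hf : IsFrobeniusBasis S f) (X : Matrix n n ℂ) {Y : Matrix n n ℂ}
    (hY : Y ∈ S) : trace (Yᴴ * (X - frobeniusProj f X)) = 0 := by
  have h : trace (Yᴴ * X) = ∑ i, trace (Yᴴ * f i) * trace ((f i)ᴴ * X) := by
    conv_lhs => rw [← hf.sum_eq Y hY]
    simp only [conjTranspose_sum, conjTranspose_smul, Finset.sum_mul, trace_sum, smul_mul_assoc,
      trace_smul, trace_conjTranspose_mul_comm, smul_eq_mul]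
  rw [mul_sub, trace_sub, h, frobeniusProj]
  simp [Finset.mul_sum, trace_sum, mul_comm]

theorem conjTranspose (hf : IsFrobeniusBasis S f) (hS : ∀ X ∈ S, Xᴴ ∈ S) :
    IsFrobeniusBasis S fun i => (f i)ᴴ where
  mem i := hS _ (hf.mem i)
  trace_eq i j := by
    rw [conjTranspose_conjTranspose, trace_mul_comm, hf.trace_eq]
    simp only [eq_comm]
  sum_eq X hX := by
    have h := congrArg Matrix.conjTranspose (hf.sum_eq _ (hS X hX))
    simp only [conjTranspose_sum, conjTranspose_smul, trace_conjTranspose_mul_comm] at h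
    simp only [conjTranspose_conjTranspose] at h ⊢
    simpa only [fun i => trace_mul_comm (f i) X,
      fun i => trace_mul_comm (f i)ᴴ Xᴴ] using h

theorem trace_sum_mul_conjTranspose (hf : IsFrobeniusBasis S f) :
    trace (∑ i, f i * (f i)ᴴ) = Fintype.card ι := by
  simp [trace_sum, trace_mul_comm (f _), hf.trace_eq]

end IsFrobeniusBasis

variable [DecidableEq n]

section

variable {A : StarSubalgebra ℂ (Matrix n n ℂ)} {ι κ : Type*} [Fintype ι] [DecidableEq ι]
  [Fintype κ] [DecidableEq κ] {f : ι → Matrix n n ℂ} {g : κ → Matrix n n ℂ}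

theorem conjTranspose_mem_commSub {X : Matrix n n ℂ} (hX : X ∈ commSub A) : Xᴴ ∈ commSub A := by
  intro Y hY
  have h := congrArg Matrix.conjTranspose (hX _ (star_mem hY))
  simpa [star_eq_conjTranspose] using h.symm

theorem one_mem_commSub : (1 : Matrix n n ℂ) ∈ commSub A := fun Y _ => by simp

theorem krausSum_mem_commSub (hf : IsFrobeniusBasis (Subalgebra.toSubmodule A.toSubalgebra) f)
    (X : Matrix n n ℂ) : krausSum f X ∈ commSub A := by
  intro Y hY
  have h1 : ∀ i, Y * f i = ∑ j, trace ((f j)ᴴ * (Y * f i)) • f j := fun i =>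
    (hf.sum_eq _ (A.mul_mem hY (hf.mem i))).symm
  have h2 : ∀ j, (f j)ᴴ * Y = ∑ i, trace ((f j)ᴴ * (Y * f i)) • (f i)ᴴ := fun j => by
    have h := congrArg Matrix.conjTranspose
      (hf.sum_eq (star Y * f j) (A.mul_mem (star_mem (s := A) hY) (hf.mem j)))
    simp only [conjTranspose_sum, conjTranspose_smul, trace_conjTranspose_mul_comm] at h
    simpa [star_eq_conjTranspose, mul_assoc] using h.symm
  simp only [krausSum, Finset.sum_mul, Finset.mul_sum]
  calc ∑ i, f i * X * (f i)ᴴ * Y = ∑ i, ∑ j, trace ((f i)ᴴ * (Y * f j)) • (f i * X * (f j)ᴴ) := by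
        refine Finset.sum_congr rfl fun i _ => ?_
        rw [mul_assoc, h2 i, Finset.mul_sum]
        simp only [mul_smul_comm]
    _ = ∑ j, ∑ i, trace ((f i)ᴴ * (Y * f j)) • (f i * X * (f j)ᴴ) := Finset.sum_comm
    _ = ∑ j, Y * (f j * X * (f j)ᴴ) := by
        refine Finset.sum_congr rfl fun j _ => ?_
        rw [← mul_assoc, ← mul_assoc]
        conv_rhs => rw [h1 j]
        simp only [Finset.sum_mul, smul_mul_assoc]

open scoped ComplexOrder in
theorem krausSum_eq_mul_frobeniusProj
    (hf : IsFrobeniusBasis (Subalgebra.toSubmodule A.toSubalgebra) f)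
    (hg : IsFrobeniusBasis (commSub A) g) (X : Matrix n n ℂ) :
    krausSum f X = (∑ i, f i * (f i)ᴴ) * frobeniusProj g X := by
  have h : krausSum f (X - frobeniusProj g X) = 0 := by
    rw [← trace_conjTranspose_mul_self_eq_zero_iff, trace_conjTranspose_mul_krausSum]
    exact hg.trace_sub_frobeniusProj X
      (krausSum_mem_commSub (hf.conjTranspose fun Y hY => star_mem (s := A) hY) _)
  have h2 : krausSum f X = krausSum f (frobeniusProj g X) := by
    rw [← sub_eq_zero, ← h]
    simp only [krausSum, mul_sub, sub_mul, Finset.sum_sub_distrib]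
  rw [h2, krausSum, Finset.sum_mul]
  refine Finset.sum_congr rfl fun i _ => ?_
  rw [mul_assoc, mul_assoc]
  exact congrArg _ (hg.frobeniusProj_mem X _ (star_mem (s := A) (hf.mem i)))

theorem sum_mul_conjTranspose_mul_sum_mul_conjTranspose
    (hf : IsFrobeniusBasis (Subalgebra.toSubmodule A.toSubalgebra) f)
    (hg : IsFrobeniusBasis (commSub A) g) :
    (∑ i, f i * (f i)ᴴ) * (∑ i, g i * (g i)ᴴ) = 1 := by
  ext i j
  have h : ∀ k, krausSum f (single j k 1) i k =
      ((∑ i, f i * (f i)ᴴ) * frobeniusProj g (single j k 1)) i k := fun k => by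
    rw [krausSum_eq_mul_frobeniusProj hf hg]
  have h1 : ∑ k, krausSum f (single j k 1) i k = (1 : Matrix n n ℂ) i j := by
    rw [← hf.sum_eq 1 A.one_mem]
    simp only [krausSum, Matrix.sum_apply, Matrix.smul_apply, mul_one]
    rw [Finset.sum_comm]
    refine Finset.sum_congr rfl fun α _ => ?_
    simp [Matrix.mul_apply, Matrix.single_apply, trace, Finset.mul_sum, mul_comm, ite_and]
  have h2 : ∑ k, ((∑ i, f i * (f i)ᴴ) * frobeniusProj g (single j k 1)) i k =
      ((∑ i, f i * (f i)ᴴ) * (∑ i, g i * (g i)ᴴ)) i j := by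
    simp only [frobeniusProj, Finset.mul_sum, Matrix.sum_apply, mul_smul_comm, Matrix.smul_apply]
    rw [Finset.sum_comm]
    refine Finset.sum_congr rfl fun β _ => ?_
    rw [← mul_assoc, Matrix.mul_apply]
    refine Finset.sum_congr rfl fun k _ => ?_
    simp [trace_mul_single, mul_comm]
  rw [← h1, ← h2]
  exact Finset.sum_congr rfl fun k _ => (h k).symm

open scoped ComplexOrder in
theorem sum_mul_conjTranspose_eq_smul_one [Nonempty n]
    (hf : IsFrobeniusBasis (Subalgebra.toSubmodule A.toSubalgebra) f)
    (hg : IsFrobeniusBasis (commSub A) g)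
    (hcard : Fintype.card ι * Fintype.card κ = Fintype.card n ^ 2) :
    ∑ i, f i * (f i)ᴴ = ((Fintype.card ι : ℂ) / Fintype.card n) • (1 : Matrix n n ℂ) := by
  obtain ⟨z, hz⟩ : ∃ z, z = ∑ i, f i * (f i)ᴴ := ⟨_, rfl⟩
  obtain ⟨w, hw⟩ : ∃ w, w = ∑ i, g i * (g i)ᴴ := ⟨_, rfl⟩
  obtain ⟨t, ht⟩ : ∃ t : ℂ, t = (Fintype.card ι : ℂ) / Fintype.card n := ⟨_, rfl⟩
  have hzw : z * w = 1 := by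
    rw [hz, hw, sum_mul_conjTranspose_mul_sum_mul_conjTranspose hf hg]
  have htz : trace z = Fintype.card ι := by rw [hz, hf.trace_sum_mul_conjTranspose]
  have htw : trace w = Fintype.card κ := by rw [hw, hg.trace_sum_mul_conjTranspose]
  have hzt : (z - t • 1)ᴴ = z - t • 1 := by
    simp [hz, ht, conjTranspose_sum]
  have hsum : ∑ i, trace (((z - t • 1) * g i)ᴴ * ((z - t • 1) * g i)) = 0 := by
    have h1 : ∑ i, trace (((z - t • 1) * g i)ᴴ * ((z - t • 1) * g i)) =
        trace ((z - t • 1) * ((z - t • 1) * w)) := by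
      rw [hw, Finset.mul_sum, Finset.mul_sum, trace_sum]
      refine Finset.sum_congr rfl fun i _ => ?_
      rw [conjTranspose_mul, hzt, mul_assoc, trace_mul_comm]
      simp only [mul_assoc]
    have h2 : (z - t • 1) * ((z - t • 1) * w) = z - (2 * t) • 1 + t ^ 2 • w := by
      have h3 : (z - t • 1) * w = 1 - t • w := by rw [sub_mul, hzw, smul_mul_assoc, one_mul]
      rw [h3, sub_mul, mul_sub, mul_sub, mul_smul_comm, hzw, mul_one, mul_one, smul_mul_assoc,
        one_mul]
      module
    have hc : (Fintype.card ι : ℂ) * Fintype.card κ = (Fintype.card n : ℂ) ^ 2 := by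
      exact_mod_cast hcard
    have hn : (Fintype.card n : ℂ) ≠ 0 := by simp
    rw [h1, h2, trace_add, trace_sub, trace_smul, trace_smul, htz, htw, trace_one, ht, smul_eq_mul,
      smul_eq_mul]
    field_simp
    linear_combination (Fintype.card ι : ℂ) * hc
  have hzero : ∀ i, (z - t • 1) * g i = 0 := fun i => by
    rw [← trace_conjTranspose_mul_self_eq_zero_iff]
    exact (Finset.sum_eq_zero_iff_of_nonneg
      fun i _ => (posSemidef_conjTranspose_mul_self _).trace_nonneg).1 hsum i (Finset.mem_univ i)
  rw [← hz, ← ht, ← sub_eq_zero, ← mul_one (z - t • 1)]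
  rw [show (z - t • 1) * 1 = (z - t • 1) * ∑ i, trace ((g i)ᴴ * 1) • g i by
    rw [hg.sum_eq 1 one_mem_commSub]]
  simp [Finset.mul_sum, hzero]

end

theorem trace_mul_map_conjTranspose (L : Matrix n n ℂ →ₗ[ℂ] Matrix n n ℂ) (U : Matrix n n ℂ) :
    trace (U * L Uᴴ) = ∑ k, ∑ l, ∑ i, ∑ j,
      L (single k l 1) j i * trace (single l i 1 * (U * single j k 1 * Uᴴ)) := by
  conv_lhs => rw [matrix_eq_sum_single Uᴴ]
  simp only [map_sum, Finset.mul_sum, trace_sum]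
  refine Finset.sum_congr rfl fun k _ => Finset.sum_congr rfl fun l _ => ?_
  have h : single k l (Uᴴ k l) = Uᴴ k l • single k l (1 : ℂ) := by simp
  rw [h, map_smul, mul_smul_comm, trace_smul, trace, smul_eq_mul, Finset.mul_sum]
  refine Finset.sum_congr rfl fun i _ => ?_
  rw [diag_apply, Matrix.mul_apply, Finset.mul_sum]
  refine Finset.sum_congr rfl fun j _ => ?_
  rw [trace_single_mul]
  simp [Matrix.mul_apply, Matrix.single_apply, ite_and]
  ring

/-- The average of `U * X * Uᴴ` over the measure `μ`. -/
def twirl (μ : Measure (Matrix n n ℂ)) (X : Matrix n n ℂ) : Matrix n n ℂ :=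
  of fun i l => ∫ U, (U * X * Uᴴ) i l ∂μ

namespace IsHaar

variable {A : StarSubalgebra ℂ (Matrix n n ℂ)} {μ : Measure (Matrix n n ℂ)}

theorem ae_mem (hμ : IsHaar A μ) : ∀ᵐ U ∂μ, U ∈ A ∧ U ∈ unitary (Matrix n n ℂ) := hμ.2.1

theorem integrable_conj_entry (hμ : IsHaar A μ) (X : Matrix n n ℂ) (i l : n) :
    Integrable (fun U => (U * X * Uᴴ) i l) μ := by
  have := hμ.1
  simp only [Matrix.mul_apply, Finset.sum_mul]
  refine integrable_finsetSum _ fun j _ => integrable_finsetSum _ fun k _ => ?_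
  refine Integrable.of_bound (C := ‖X k j‖) ?_ ?_
  · exact (((measurable_entry i k).mul_const _).mul
      (continuous_star.measurable.comp (measurable_entry l j))).aestronglyMeasurable
  · filter_upwards [hμ.ae_mem] with U hU
    have h := fun a b => entry_norm_bound_of_unitary hU.2 a b
    rw [norm_mul, norm_mul, conjTranspose_apply, norm_star]
    calc ‖U i k‖ * ‖X k j‖ * ‖U l j‖ ≤ 1 * ‖X k j‖ * 1 := by gcongr <;> apply h
      _ = ‖X k j‖ := by ring

theorem integrable_trace_mul_conj (hμ : IsHaar A μ) (W X : Matrix n n ℂ) :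
    Integrable (fun U => trace (W * (U * X * Uᴴ))) μ := by
  simp only [trace_mul_eq_sum W]
  exact integrable_finsetSum _ fun i _ => integrable_finsetSum _ fun j _ =>
    (hμ.integrable_conj_entry X j i).const_mul _

theorem integral_trace_mul_conj (hμ : IsHaar A μ) (W X : Matrix n n ℂ) :
    ∫ U, trace (W * (U * X * Uᴴ)) ∂μ = trace (W * twirl μ X) := by
  have hint := fun i j => (hμ.integrable_conj_entry X j i).const_mul (W i j)
  simp only [trace_mul_eq_sum W]
  rw [integral_finsetSum _ fun i _ => integrable_finsetSum _ fun j _ => hint i j]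
  refine Finset.sum_congr rfl fun i _ => ?_
  rw [integral_finsetSum _ fun j _ => hint i j]
  refine Finset.sum_congr rfl fun j _ => ?_
  rw [integral_const_mul]
  rfl

theorem unitary_mul_twirl_mul (hμ : IsHaar A μ) {V : Matrix n n ℂ} (hVA : V ∈ A)
    (hV : V ∈ unitary (Matrix n n ℂ)) (X : Matrix n n ℂ) :
    V * twirl μ X * Vᴴ = twirl μ X := by
  ext i l
  have h : ∀ M : Matrix n n ℂ, (V * M * Vᴴ) i l = trace (Vᴴ * single l i 1 * V * M) := by
    intro M
    rw [← one_smul ℂ ((V * M * Vᴴ) i l), ← trace_single_mul, ← mul_assoc, trace_mul_comm]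
    simp only [mul_assoc]
  have hinv := hμ.2.2 V hVA hV
  calc (V * twirl μ X * Vᴴ) i l = ∫ U, (V * (U * X * Uᴴ) * Vᴴ) i l ∂μ := by
        simp only [h]
        rw [hμ.integral_trace_mul_conj]
    _ = ∫ U, (V * U * X * (V * U)ᴴ) i l ∂μ := by
        simp only [conjTranspose_mul, mul_assoc]
    _ = ∫ U, (U * X * Uᴴ) i l ∂(μ.map fun U => V * U) := by
        rw [integral_map (measurable_const_mul_matrix V).aemeasurable]
        rw [hinv]
        exact (hμ.integrable_conj_entry X i l).aestronglyMeasurable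
    _ = twirl μ X i l := by rw [hinv]; rfl

theorem twirl_mem_commSub (hμ : IsHaar A μ) (X : Matrix n n ℂ) : twirl μ X ∈ commSub A := by
  intro Y hY
  have h := mem_span_unitary A hY
  clear hY
  induction h using Submodule.span_induction with
  | mem V hV =>
    conv_lhs => rw [← hμ.unitary_mul_twirl_mul hV.1 hV.2 X]
    rw [mul_assoc, ← star_eq_conjTranspose V, Unitary.star_mul_self_of_mem hV.2, mul_one]
  | zero => simp
  | add Y Z _ _ hY hZ => rw [mul_add, add_mul, hY, hZ]
  | smul c Y _ hY => rw [mul_smul_comm, smul_mul_assoc, hY]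

theorem trace_sub_twirl (hμ : IsHaar A μ) (X : Matrix n n ℂ) {Y : Matrix n n ℂ}
    (hY : Y ∈ commSub A) : trace (Yᴴ * (X - twirl μ X)) = 0 := by
  have := hμ.1
  have h : ∫ U, trace (Yᴴ * (U * X * Uᴴ)) ∂μ = ∫ _, trace (Yᴴ * X) ∂μ := by
    refine integral_congr_ae ?_
    filter_upwards [hμ.ae_mem] with U hU
    rw [← mul_assoc, ← mul_assoc, conjTranspose_mem_commSub hY U hU.1, trace_mul_comm,
      ← mul_assoc, ← mul_assoc, ← star_eq_conjTranspose U, Unitary.star_mul_self_of_mem hU.2,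
      one_mul]
  rw [mul_sub, trace_sub, ← hμ.integral_trace_mul_conj, h]
  simp

theorem integrable_trace_mul_map (hμ : IsHaar A μ) (L : Matrix n n ℂ →ₗ[ℂ] Matrix n n ℂ) :
    Integrable (fun U => trace (U * L Uᴴ)) μ := by
  simp only [trace_mul_map_conjTranspose]
  exact integrable_finsetSum _ fun k _ => integrable_finsetSum _ fun l _ =>
    integrable_finsetSum _ fun i _ => integrable_finsetSum _ fun j _ =>
    (hμ.integrable_trace_mul_conj _ _).const_mul _

theorem integral_trace_mul_map (hμ : IsHaar A μ) (L : Matrix n n ℂ →ₗ[ℂ] Matrix n n ℂ)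
    {ι : Type*} [Fintype ι] {f : ι → Matrix n n ℂ} {c : ℂ}
    (h : ∀ X, twirl μ X = c • krausSum f X) :
    ∫ U, trace (U * L Uᴴ) ∂μ = c * ∑ a, trace (f a * L (f a)ᴴ) := by
  have hint := fun k l i j => (hμ.integrable_trace_mul_conj (single l i 1) (single j k 1)).const_mul
    (L (single k l 1) j i)
  simp only [trace_mul_map_conjTranspose]
  rw [integral_finsetSum _ fun k _ => integrable_finsetSum _ fun l _ =>
    integrable_finsetSum _ fun i _ => integrable_finsetSum _ fun j _ => hint k l i j]
  rw [Finset.sum_comm, Finset.mul_sum]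
  refine Finset.sum_congr rfl fun k _ => ?_
  rw [integral_finsetSum _ fun l _ =>
    integrable_finsetSum _ fun i _ => integrable_finsetSum _ fun j _ => hint k l i j]
  rw [Finset.sum_comm, Finset.mul_sum]
  refine Finset.sum_congr rfl fun l _ => ?_
  rw [integral_finsetSum _ fun i _ => integrable_finsetSum _ fun j _ => hint k l i j]
  rw [Finset.sum_comm, Finset.mul_sum]
  refine Finset.sum_congr rfl fun i _ => ?_
  rw [integral_finsetSum _ fun j _ => hint k l i j]
  rw [Finset.sum_comm, Finset.mul_sum]
  refine Finset.sum_congr rfl fun j _ => ?_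
  rw [integral_const_mul, hμ.integral_trace_mul_conj, h, krausSum, mul_smul_comm, trace_smul,
    smul_eq_mul, Finset.mul_sum, trace_sum, ← Finset.mul_sum]
  ring

end IsHaar

theorem hs2_commutator {U V : Matrix n n ℂ} (hU : U ∈ unitary (Matrix n n ℂ))
    (hV : V ∈ unitary (Matrix n n ℂ)) :
    hs2 (U * V - V * U) = 2 * Fintype.card n - 2 * (trace (U * (V * Uᴴ * Vᴴ))).re := by
  have hU' : Uᴴ * U = 1 := Unitary.star_mul_self_of_mem hU
  have hV' : Vᴴ * V = 1 := Unitary.star_mul_self_of_mem hV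
  have hUV : (U * V)ᴴ * (U * V) = 1 := by
    rw [conjTranspose_mul, mul_assoc, ← mul_assoc Uᴴ, hU', one_mul, hV']
  have hVU : (V * U)ᴴ * (V * U) = 1 := by
    rw [conjTranspose_mul, mul_assoc, ← mul_assoc Vᴴ, hV', one_mul, hU']
  have h1 : trace ((V * U)ᴴ * (U * V)) = trace (U * (V * Uᴴ * Vᴴ)) := by
    rw [trace_mul_comm, conjTranspose_mul]
    simp only [mul_assoc]
  have h2 : (trace ((U * V)ᴴ * (V * U))).re = (trace (U * (V * Uᴴ * Vᴴ))).re := by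
    rw [← h1, ← trace_conjTranspose_mul_comm]
    simp
  rw [hs2, conjTranspose_sub, sub_mul, mul_sub, mul_sub, hUV, hVU]
  simp only [trace_sub, Complex.sub_re, h1, h2, trace_one, Complex.natCast_re]
  ring

theorem MAN_eq {A B : StarSubalgebra ℂ (Matrix n n ℂ)} {μ ν : Measure (Matrix n n ℂ)}
    (hμ : IsHaar A μ) (hν : IsHaar B ν) [Nonempty n] {L : Matrix n n ℂ →ₗ[ℂ] Matrix n n ℂ}
    (hL : ∀ X, twirl ν X = L X) :
    MAN μ ν = 1 - (∫ U, trace (U * L Uᴴ) ∂μ).re / Fintype.card n := by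
  have := hμ.1
  have := hν.1
  have h1 : ∀ U ∈ unitary (Matrix n n ℂ), ∫ V, hs2 (U * V - V * U) ∂ν =
      2 * Fintype.card n - 2 * (trace (U * L Uᴴ)).re := by
    intro U hU
    rw [← hL, ← hν.integral_trace_mul_conj]
    have hre : Integrable (fun V => (trace (U * (V * Uᴴ * Vᴴ))).re) ν :=
      (hν.integrable_trace_mul_conj U Uᴴ).re
    rw [show (∫ V, trace (U * (V * Uᴴ * Vᴴ)) ∂ν).re = ∫ V, (trace (U * (V * Uᴴ * Vᴴ))).re ∂ν from
      (integral_re (hν.integrable_trace_mul_conj U Uᴴ)).symm]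
    rw [integral_congr_ae (g := fun V => 2 * (Fintype.card n : ℝ) -
      2 * (trace (U * (V * Uᴴ * Vᴴ))).re)]
    · rw [integral_sub (integrable_const _) (hre.const_mul 2)]
      simp [integral_const_mul]
    · filter_upwards [hν.ae_mem] with V hV using hs2_commutator hU hV.2
  have hre : Integrable (fun U => (trace (U * L Uᴴ)).re) μ :=
    (hμ.integrable_trace_mul_map L).re
  have h2 : ∫ U, ∫ V, hs2 (U * V - V * U) ∂ν ∂μ =
      2 * Fintype.card n - 2 * (∫ U, trace (U * L Uᴴ) ∂μ).re := by
    rw [show (∫ U, trace (U * L Uᴴ) ∂μ).re = ∫ U, (trace (U * L Uᴴ)).re ∂μ from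
      (integral_re (hμ.integrable_trace_mul_map L)).symm]
    rw [integral_congr_ae (g := fun U => 2 * (Fintype.card n : ℝ) - 2 * (trace (U * L Uᴴ)).re)]
    · rw [integral_sub (integrable_const _) (hre.const_mul 2)]
      simp [integral_const_mul]
    · filter_upwards [hμ.ae_mem] with U hU using h1 U hU.2
  have hn : (Fintype.card n : ℝ) ≠ 0 := by simp
  rw [MAN, h2]
  field_simp

theorem twirl_eq_smul_krausSum [Nonempty n] {A : StarSubalgebra ℂ (Matrix n n ℂ)}
    {μ : Measure (Matrix n n ℂ)} (hμ : IsHaar A μ) {ι κ : Type*} [Fintype ι] [DecidableEq ι]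
    [Fintype κ] [DecidableEq κ] {f : ι → Matrix n n ℂ} {g : κ → Matrix n n ℂ}
    (hf : IsFrobeniusBasis (Subalgebra.toSubmodule A.toSubalgebra) f)
    (hg : IsFrobeniusBasis (commSub A) g)
    (hcard : Fintype.card ι * Fintype.card κ = Fintype.card n ^ 2) (X : Matrix n n ℂ) :
    twirl μ X = ((Fintype.card n : ℂ) / Fintype.card ι) • krausSum f X := by
  have hι : Fintype.card ι ≠ 0 := by
    rintro h
    rw [h, zero_mul] at hcard
    exact Fintype.card_ne_zero (pow_eq_zero_iff two_ne_zero |>.1 hcard.symm)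
  have hι' : (Fintype.card ι : ℂ) ≠ 0 := by exact_mod_cast hι
  have hn : (Fintype.card n : ℂ) ≠ 0 := by simp
  rw [eq_of_trace_orthogonal (hμ.twirl_mem_commSub X) (hg.frobeniusProj_mem X)
    (fun Y hY => hμ.trace_sub_twirl X hY) (fun Y hY => hg.trace_sub_frobeniusProj X hY),
    krausSum_eq_mul_frobeniusProj hf hg, sum_mul_conjTranspose_eq_smul_one hf hg hcard,
    smul_mul_assoc, one_mul, smul_smul, div_mul_div_cancel₀ hι', div_self hn, one_smul]

namespace IsFrobeniusBasis

variable {S C : Submodule ℂ (Matrix n n ℂ)} {ι κ : Type*} [Fintype ι] [DecidableEq ι]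
  [Fintype κ] [DecidableEq κ] {h : ι → Matrix n n ℂ} {c : κ → Matrix n n ℂ}

theorem trace_conjTranspose_mul_self (hc : IsFrobeniusBasis C c) (Z : Matrix n n ℂ) :
    trace (Zᴴ * Z) = ∑ j, trace (Zᴴ * c j) * trace ((c j)ᴴ * Z) +
      trace ((Z - frobeniusProj c Z)ᴴ * (Z - frobeniusProj c Z)) := by
  rw [conjTranspose_sub, sub_mul, trace_sub,
    hc.trace_sub_frobeniusProj Z (hc.frobeniusProj_mem Z), sub_zero, mul_sub, trace_sub]
  simp [frobeniusProj, Finset.mul_sum, trace_sum, mul_comm]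

/-- `P` acts as a projection that is self-adjoint for the Frobenius inner product and fixes `C`. -/
theorem sum_trace_conjTranspose_mul_map (hh : IsFrobeniusBasis S h) (hc : IsFrobeniusBasis C c)
    (hCS : C ≤ S) {P : Matrix n n ℂ → Matrix n n ℂ}
    (hP : ∀ X, trace ((P X)ᴴ * (X - P X)) = 0)
    (hPC : ∀ X, ∀ Y ∈ C, trace (Yᴴ * (X - P X)) = 0) :
    ∑ i, trace ((h i)ᴴ * P (h i)) = Fintype.card κ +
      ∑ i, trace ((P (h i) - frobeniusProj c (P (h i)))ᴴ *
        (P (h i) - frobeniusProj c (P (h i)))) := by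
  have h1 : ∀ X, trace (Xᴴ * P X) = trace ((P X)ᴴ * P X) := fun X => by
    have h2 := hP X
    rw [mul_sub, trace_sub, sub_eq_zero] at h2
    rw [← trace_conjTranspose_mul_comm, h2, trace_conjTranspose_mul_comm]
  have h3 : ∀ X j, trace ((c j)ᴴ * P X) = trace ((c j)ᴴ * X) := fun X j => by
    have h2 := hPC X _ (hc.mem j)
    rw [mul_sub, trace_sub, sub_eq_zero] at h2
    exact h2.symm
  have h4 : ∀ X j, trace ((P X)ᴴ * c j) = trace (Xᴴ * c j) := fun X j => by
    rw [← trace_conjTranspose_mul_comm, h3, trace_conjTranspose_mul_comm]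
  have h5 : ∀ j, ∑ i, trace ((h i)ᴴ * c j) * trace ((c j)ᴴ * h i) = 1 := fun j => by
    calc _ = trace ((c j)ᴴ * ∑ i, trace ((h i)ᴴ * c j) • h i) := by
          simp [Finset.mul_sum, trace_sum]
      _ = 1 := by rw [hh.sum_eq _ (hCS (hc.mem j)), hc.trace_eq, if_pos rfl]
  simp only [h1]
  rw [Finset.sum_congr rfl fun i _ => hc.trace_conjTranspose_mul_self (P (h i)),
    Finset.sum_add_distrib, Finset.sum_comm]
  simp [h3, h4, h5]

end IsFrobeniusBasis

end

/-- For `A` collinear: `S(A:B) ≤ 1 - dim(A ∩ B')/dim A`, with equality when the two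
orthogonal projections commute. -/
theorem stmt_18 (d : ℕ) (hd : 0 < d)
    (A B : StarSubalgebra ℂ (Matrix (Fin d) (Fin d) ℂ))
    (hcol : Module.finrank ℂ ↥(Subalgebra.toSubmodule A.toSubalgebra) *
      Module.finrank ℂ ↥(commSub A) = d ^ 2)
    (PA PB : Matrix (Fin d) (Fin d) ℂ →ₗ[ℂ] Matrix (Fin d) (Fin d) ℂ)
    (hPA1 : ∀ X, PA X ∈ A)
    (hPA2 : ∀ X, ∀ Y ∈ A, Matrix.trace (Yᴴ * (X - PA X)) = 0)
    (hPB1 : ∀ X, ∀ Y ∈ B, PB X * Y = Y * PB X)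
    (hPB2 : ∀ X (Y : Matrix (Fin d) (Fin d) ℂ), (∀ Z ∈ B, Y * Z = Z * Y) →
      Matrix.trace (Yᴴ * (X - PB X)) = 0)
    (μ ν : Measure (Matrix (Fin d) (Fin d) ℂ))
    (hμ : IsHaar A μ) (hν : IsHaar B ν) :
    MAN μ ν ≤ 1 -
      (Module.finrank ℂ ↥(Subalgebra.toSubmodule A.toSubalgebra ⊓ commSub B) : ℝ) /
        (Module.finrank ℂ ↥(Subalgebra.toSubmodule A.toSubalgebra) : ℝ) ∧
    (PA ∘ₗ PB = PB ∘ₗ PA →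
      MAN μ ν = 1 -
        (Module.finrank ℂ ↥(Subalgebra.toSubmodule A.toSubalgebra ⊓ commSub B) : ℝ) /
          (Module.finrank ℂ ↥(Subalgebra.toSubmodule A.toSubalgebra) : ℝ)) := by
  have : Nonempty (Fin d) := ⟨⟨0, hd⟩⟩
  obtain ⟨f, hf⟩ := exists_isFrobeniusBasis (Subalgebra.toSubmodule A.toSubalgebra)
  obtain ⟨g, hg⟩ := exists_isFrobeniusBasis (commSub A)
  obtain ⟨c, hc⟩ := exists_isFrobeniusBasis (Subalgebra.toSubmodule A.toSubalgebra ⊓ commSub B)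
  have htwirl := twirl_eq_smul_krausSum hμ hf hg (by simpa using hcol)
  have hB : ∀ X, twirl ν X = PB X := fun X =>
    eq_of_trace_orthogonal (hν.twirl_mem_commSub X) (fun Y hY => hPB1 X Y hY)
      (fun Y hY => hν.trace_sub_twirl X hY) (fun Y hY => hPB2 X Y hY)
  have hsum := (hf.conjTranspose fun Y hY => star_mem (s := A) hY).sum_trace_conjTranspose_mul_map
    hc
    inf_le_left (P := PB) (fun X => hPB2 X _ (hPB1 X)) (fun X Y hY => hPB2 X Y hY.2)
  simp only [conjTranspose_conjTranspose, Fintype.card_fin] at hsum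
  obtain ⟨R, hR⟩ : ∃ R : Fin _ → Matrix (Fin d) (Fin d) ℂ,
      ∀ i, R i = PB (f i)ᴴ - frobeniusProj c (PB (f i)ᴴ) := ⟨_, fun _ => rfl⟩
  simp only [← hR] at hsum
  obtain ⟨E, hE⟩ : ∃ E, E = ∑ i, trace ((R i)ᴴ * R i) := ⟨_, rfl⟩
  have hMAN := MAN_eq hμ hν hB
  rw [hμ.integral_trace_mul_map PB htwirl, hsum, ← hE] at hMAN
  obtain ⟨a, ha⟩ : ∃ a, a = finrank ℂ (Subalgebra.toSubmodule A.toSubalgebra) := ⟨_, rfl⟩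
  have ha0 : (0 : ℝ) < a := by
    have : 0 < a := by
      rcases Nat.eq_zero_or_pos a with h | h
      · rw [← ha, h, zero_mul] at hcol
        exact absurd hcol.symm (by positivity)
      · exact h
    exact_mod_cast this
  have hd0 : (d : ℝ) ≠ 0 := by positivity
  have hMAN' : MAN μ ν = 1 -
      (finrank ℂ ↥(Subalgebra.toSubmodule A.toSubalgebra ⊓ commSub B) : ℝ) / a -
        E.re / a := by
    rw [hMAN, Fintype.card_fin, Fintype.card_fin, ← ha, ← Complex.ofReal_natCast d,
      ← Complex.ofReal_natCast a, ← Complex.ofReal_div, Complex.re_ofReal_mul, Complex.add_re,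
      Complex.natCast_re]
    field_simp
    ring
  rw [← ha, hMAN']
  refine ⟨?_, fun hcomm => ?_⟩
  · have hnn : 0 ≤ E.re := by
      rw [hE, Complex.re_sum]
      exact Finset.sum_nonneg fun i _ =>
        re_trace_conjTranspose_mul_self_nonneg (R i)
    have := div_nonneg hnn ha0.le
    linarith
  · have hR0 : ∀ i, R i = 0 := fun i => by
      have hfi : (f i)ᴴ ∈ A := star_mem (s := A) (hf.mem i)
      have hPA : PA (f i)ᴴ = (f i)ᴴ :=
        eq_of_trace_orthogonal (S := Subalgebra.toSubmodule A.toSubalgebra) (hPA1 _) hfi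
          (fun Y hY => hPA2 _ Y hY) (fun Y _ => by simp)
      have hmem : PB (f i)ᴴ ∈ Subalgebra.toSubmodule A.toSubalgebra ⊓ commSub B := by
        refine ⟨?_, fun Y hY => hPB1 _ Y hY⟩
        have h := LinearMap.congr_fun hcomm (f i)ᴴ
        rw [LinearMap.comp_apply, LinearMap.comp_apply, hPA] at h
        rw [← h]
        exact hPA1 _
      rw [hR]
      exact sub_eq_zero.2 (hc.sum_eq _ hmem).symm
    simp [hE, hR0]
end
end
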